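/- Let F = ℂ(λ, z) be the field of rational functions in two variables λ, z over ℂ, and let B = F[Y,W]/(z·W² + Y² + W + z³ − λ). Then there is no F-algebra isomorphism between B and the univariate polynomial ring F[T]. (The generic fiber of the fibration ξ₀ = (f, pr_z) : 𝔸³ → 𝔸² of Example 4.4 is not isomorphic to the affine line over ℂ(λ, z); in particular ξ₀ is an 𝔸¹_*-fibration and not an 𝔸¹-fibration.) -/

import Mathlib

open MvPolynomial

/-- `F = ℂ(λ, z)`, the field of rational functions in two variables over ℂ,
realized as the fraction field of `ℂ[λ][z]`. -/
abbrev Ffield : Type := FractionRing (Polynomial (Polynomial ℂ))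

/-- The rational function `λ` (the first variable). -/
noncomputable def lam : Ffield :=
  algebraMap (Polynomial (Polynomial ℂ)) Ffield (Polynomial.C Polynomial.X)

/-- The rational function `z` (the second variable). -/
noncomputable def zz : Ffield :=
  algebraMap (Polynomial (Polynomial ℂ)) Ffield Polynomial.X

/-- `-z` is not a square in `F`, in the form: `z a² + b² = 0` forces `a = 0`. -/
theorem zz_aniso (a b : Ffield) (h : zz * a ^ 2 + b ^ 2 = 0) : a = 0 := by
  by_contra ha
  obtain ⟨p, q, hq, hpq⟩ := IsFractionRing.div_surjective (A := Polynomial (Polynomial ℂ)) (b / a)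
  have hq0 : q ≠ 0 := nonZeroDivisors.ne_zero hq
  have hq' : algebraMap (Polynomial (Polynomial ℂ)) Ffield q ≠ 0 := by
    simpa using hq0
  have h1 : (b / a) ^ 2 = - zz := by
    field_simp
    linear_combination h
  rw [← hpq, div_pow, div_eq_iff (pow_ne_zero 2 hq'), zz, ← map_neg, ← map_pow, ← map_pow,
    ← map_mul] at h1
  have h2 := IsFractionRing.injective (Polynomial (Polynomial ℂ)) Ffield h1
  have h3 := congrArg Polynomial.natDegree h2
  rw [Polynomial.natDegree_mul (neg_ne_zero.2 Polynomial.X_ne_zero) (pow_ne_zero 2 hq0),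
    Polynomial.natDegree_neg, Polynomial.natDegree_X, Polynomial.natDegree_pow,
    Polynomial.natDegree_pow] at h3
  omega

/-- Every polynomial solution of the equation of the curve is constant. -/
theorem sol_const (y w : Polynomial Ffield)
    (h : Polynomial.C zz * w ^ 2 + y ^ 2 + w + Polynomial.C (zz ^ 3) - Polynomial.C lam = 0) :
    max w.natDegree y.natDegree = 0 := by
  by_contra hn
  obtain ⟨n, hnd⟩ : ∃ n, n = max w.natDegree y.natDegree := ⟨_, rfl⟩
  rw [← hnd] at hn
  have hw : w.natDegree ≤ n := hnd ▸ le_max_left _ _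
  have hy : y.natDegree ≤ n := hnd ▸ le_max_right _ _
  have hc := congrArg (fun p => Polynomial.coeff p (2 * n)) h
  simp only [Polynomial.coeff_sub, Polynomial.coeff_add, Polynomial.coeff_C_mul,
    Polynomial.coeff_zero] at hc
  rw [Polynomial.coeff_pow_of_natDegree_le hw, Polynomial.coeff_pow_of_natDegree_le hy,
    Polynomial.coeff_eq_zero_of_natDegree_lt (p := w) (n := 2 * n) (by omega),
    Polynomial.coeff_C_of_ne_zero (by omega), Polynomial.coeff_C_of_ne_zero (by omega)] at hc
  simp only [add_zero, sub_zero] at hc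
  have hwn := zz_aniso _ _ hc
  have hyn : y.coeff n = 0 := by
    rw [hwn] at hc
    simpa using hc
  rcases max_choice w.natDegree y.natDegree with h' | h'
  · rw [h'] at hnd
    rw [hnd, Polynomial.coeff_natDegree, Polynomial.leadingCoeff_eq_zero] at hwn
    rw [hwn] at hnd
    exact hn (by simpa using hnd)
  · rw [h'] at hnd
    rw [hnd, Polynomial.coeff_natDegree, Polynomial.leadingCoeff_eq_zero] at hyn
    rw [hyn] at hnd
    exact hn (by simpa using hnd)

/-- The generic fiber of `ξ₀ = (f, pr_z) : 𝔸³ → 𝔸²`, `f(y,z,w) = w²z + y² + w + z³`,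
is not the affine line over `ℂ(λ, z)`: the coordinate ring
`B = F[Y,W]/(z·W² + Y² + W + z³ − λ)` is not `F`-isomorphic to the univariate
polynomial ring `F[T]` (here `Y = X 0`, `W = X 1`). -/
theorem generic_fiber_not_affine_line :
    IsEmpty ((MvPolynomial (Fin 2) Ffield ⧸
        Ideal.span ({C zz * X 1 ^ 2 + X 0 ^ 2 + X 1 + C (zz ^ 3) - C lam} :
          Set (MvPolynomial (Fin 2) Ffield)))
      ≃ₐ[Ffield] Polynomial Ffield) := by
  refine ⟨fun e => ?_⟩
  set I := Ideal.span ({C zz * X 1 ^ 2 + X 0 ^ 2 + X 1 + C (zz ^ 3) - C lam} :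
          Set (MvPolynomial (Fin 2) Ffield)) with hI
  let g : MvPolynomial (Fin 2) Ffield →ₐ[Ffield] Polynomial Ffield :=
    e.toAlgHom.comp (Ideal.Quotient.mkₐ Ffield I)
  have hsurj : Function.Surjective g :=
    e.surjective.comp (Ideal.Quotient.mkₐ_surjective Ffield I)
  have hgC : ∀ a, g (C a) = Polynomial.C a := fun a => g.commutes a
  have hrel : g (C zz * X 1 ^ 2 + X 0 ^ 2 + X 1 + C (zz ^ 3) - C lam) = 0 := by
    have : Ideal.Quotient.mkₐ Ffield I
        (C zz * X 1 ^ 2 + X 0 ^ 2 + X 1 + C (zz ^ 3) - C lam) = 0 :=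
      Ideal.Quotient.eq_zero_iff_mem.2 (Ideal.subset_span rfl)
    change e _ = 0
    exact (congrArg e this).trans (map_zero e)
  rw [map_sub, map_add, map_add, map_add, map_mul, map_pow, map_pow, hgC, hgC, hgC] at hrel
  have hdeg := sol_const _ _ hrel
  have h1 : (g (X 1)).natDegree = 0 := by omega
  have h0 : (g (X 0)).natDegree = 0 := by omega
  have hall : ∀ P, (g P).natDegree = 0 := by
    intro P
    induction P using MvPolynomial.induction_on with
    | C a => rw [hgC, Polynomial.natDegree_C]
    | add p q hp hq =>
      rw [map_add]
      have := Polynomial.natDegree_add_le (g p) (g q)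
      omega
    | mul_X p i hp =>
      rw [map_mul]
      have := Polynomial.natDegree_mul_le (p := g p) (q := g (X i))
      have hi : (g (X i)).natDegree = 0 := by
        fin_cases i
        · exact h0
        · exact h1
      omega
  obtain ⟨P, hP⟩ := hsurj Polynomial.X
  have := hall P
  rw [hP, Polynomial.natDegree_X] at this
  exact one_ne_zero this
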